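/- Let k be an algebraically closed field of characteristic coprime to 6 and let C = {q = 0} be a reduced plane quartic (q squarefree) all of whose singular points have multiplicity 2. Then the common zero locus {[u,v,w] ∈ P²(k) : H(q)(u,v,w) = 0 and K(q)(u,v,w) = 0} in the dual projective plane is finite; equivalently, C has only finitely many inflection lines. -/

import Mathlib

open MvPolynomial

noncomputable section

/-- The classical invariant `S` of a binary quartic form with coefficients `f 0, …, f 4`. -/
def Sinv {R : Type*} [CommRing R] (f : Fin 5 → R) : R :=
  12 * f 0 * f 4 - 3 * f 1 * f 3 + f 2 ^ 2

/-- The classical invariant `T` of a binary quartic form with coefficients `f 0, …, f 4`. -/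
def Tinv {R : Type*} [CommRing R] (f : Fin 5 → R) : R :=
  72 * f 0 * f 2 * f 4 - 27 * f 0 * f 3 ^ 2 - 27 * f 1 ^ 2 * f 4
    + 9 * f 1 * f 2 * f 3 - 2 * f 2 ^ 3

/-- The binary quartic form `f₀ y⁴ + f₁ y³z + f₂ y²z² + f₃ yz³ + f₄ z⁴`. -/
def binQuartic {R : Type*} [CommRing R] (f : Fin 5 → R) : MvPolynomial (Fin 2) R :=
  ∑ i : Fin 5, C (f i) * X 0 ^ (4 - (i : ℕ)) * X 1 ^ (i : ℕ)

/-- The `i`-th coefficient of a binary quartic form: coefficient of `y^(4-i) z^i`. -/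
def binCoeff {R : Type*} [CommRing R] (g : MvPolynomial (Fin 2) R) (i : Fin 5) : R :=
  coeff (Finsupp.single 0 (4 - (i : ℕ)) + Finsupp.single 1 (i : ℕ)) g

/-- The substitution `g(y,z) = q(-v·y - w·z, u·y, u·z)`, a binary quartic form in `y, z` with
coefficients in `R[u,v,w]`. -/
def gsub {R : Type*} [CommRing R] (q : MvPolynomial (Fin 3) R) :
    MvPolynomial (Fin 2) (MvPolynomial (Fin 3) R) :=
  aeval
    (![(C (- X 1) * X 0 - C (X 2) * X 1 : MvPolynomial (Fin 2) (MvPolynomial (Fin 3) R)),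
       C (X 0) * X 0, C (X 0) * X 1]) q

/-- `u⁴ · H(q)`, the invariant `S` of `g(y,z) = q(-vy-wz, uy, uz)`; the harmonic quartic `H(q)`
is the form determined by `u⁴ · H(q) = SG q`. -/
def SG {R : Type*} [CommRing R] (q : MvPolynomial (Fin 3) R) : MvPolynomial (Fin 3) R :=
  Sinv (fun i => binCoeff (gsub q) i)

/-- `u⁶ · K(q)`, the invariant `T` of `g(y,z) = q(-vy-wz, uy, uz)`; the harmonic sextic `K(q)`
is the form determined by `u⁶ · K(q) = TG q`. -/
def TG {R : Type*} [CommRing R] (q : MvPolynomial (Fin 3) R) : MvPolynomial (Fin 3) R :=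
  Tinv (fun i => binCoeff (gsub q) i)

/-- dot product of two vectors in `R³`. -/
def dot3 {R : Type*} [CommRing R] (d a : Fin 3 → R) : R :=
  d 0 * a 0 + d 1 * a 1 + d 2 * a 2

/-- restriction of a ternary form to the parameterized line `(y,z) ↦ y·a + z·b`. -/
def restrictLine {R : Type*} [CommRing R] (q : MvPolynomial (Fin 3) R) (a b : Fin 3 → R) :
    MvPolynomial (Fin 2) R :=
  aeval (fun i => C (a i) * X 0 + C (b i) * X 1) q

/-- A binary quartic form vanishes identically or has a root of multiplicity at least `3`:
`f = L³·M` with `L ≠ 0` linear and `M` linear (possibly zero). -/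
def HasTripleRoot {R : Type*} [CommRing R] (f : MvPolynomial (Fin 2) R) : Prop :=
  ∃ L M : MvPolynomial (Fin 2) R,
    L.IsHomogeneous 1 ∧ M.IsHomogeneous 1 ∧ L ≠ 0 ∧ f = L ^ 3 * M

/-- The line with dual coordinates `d` is an inflection line of the quartic `{q = 0}`. -/
def IsInflectionLine {k : Type*} [Field k] (q : MvPolynomial (Fin 3) k) (d : Fin 3 → k) :
    Prop :=
  d ≠ 0 ∧ ∃ a b : Fin 3 → k, LinearIndependent k ![a, b] ∧
    dot3 d a = 0 ∧ dot3 d b = 0 ∧ HasTripleRoot (restrictLine q a b)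

/-- The line with dual coordinates `d` is a simple inflection line of `{q = 0}` with
inflection point `p`. -/
def IsSimpleInflectionLineAt {k : Type*} [Field k] (q : MvPolynomial (Fin 3) k)
    (d p : Fin 3 → k) : Prop :=
  d ≠ 0 ∧ ∃ (a b : Fin 3 → k) (s t : k), LinearIndependent k ![a, b] ∧
    dot3 d a = 0 ∧ dot3 d b = 0 ∧ (s, t) ≠ (0, 0) ∧
    (∀ i, p i = s * a i + t * b i) ∧
    eval p q = 0 ∧ (∃ i, eval p (pderiv i q) ≠ 0) ∧
    ∃ L M : MvPolynomial (Fin 2) k, L.IsHomogeneous 1 ∧ M.IsHomogeneous 1 ∧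
      LinearIndependent k ![L, M] ∧
      restrictLine q a b = L ^ 3 * M ∧ eval ![s, t] L = 0

/-- The line with dual coordinates `d` is a hyperinflection line of `{q = 0}` with
hyperinflection point `p`. -/
def IsHyperinflectionLineAt {k : Type*} [Field k] (q : MvPolynomial (Fin 3) k)
    (d p : Fin 3 → k) : Prop :=
  d ≠ 0 ∧ ∃ (a b : Fin 3 → k) (s t : k), LinearIndependent k ![a, b] ∧
    dot3 d a = 0 ∧ dot3 d b = 0 ∧ (s, t) ≠ (0, 0) ∧
    (∀ i, p i = s * a i + t * b i) ∧
    eval p q = 0 ∧ (∃ i, eval p (pderiv i q) ≠ 0) ∧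
    ∃ (c : k) (L : MvPolynomial (Fin 2) k), c ≠ 0 ∧ L.IsHomogeneous 1 ∧ L ≠ 0 ∧
      restrictLine q a b = C c * L ^ 4 ∧ eval ![s, t] L = 0

/-- The pairing `⟨·,·⟩` between quartic forms in `x,y,z` and quartic forms in `u,v,w`:
`⟨x^i y^j z^k, u^i v^j w^k⟩ = i!j!k!/2`. -/
def pairQ {R : Type*} [CommRing R] (q h : MvPolynomial (Fin 3) R) : R :=
  ∑ m ∈ q.support,
    (((m 0).factorial * (m 1).factorial * (m 2).factorial / 2 : ℕ) : R)
      * coeff m q * coeff m h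

/-- The action of `Σ c_{ξη} ξ ∂_η ∈ 𝔤𝔩₃(R)` on polynomials. -/
def lieAct {R : Type*} [CommRing R] (c : Fin 3 → Fin 3 → R)
    (q : MvPolynomial (Fin 3) R) : MvPolynomial (Fin 3) R :=
  ∑ ξ : Fin 3, ∑ η : Fin 3, C (c ξ η) * (X ξ * pderiv η q)

/-- substitution of variables by the linear change of coordinates `M`: `q(M·(x,y,z)ᵗ)`. -/
def substM {R : Type*} [CommRing R] (M : Matrix (Fin 3) (Fin 3) R)
    (q : MvPolynomial (Fin 3) R) : MvPolynomial (Fin 3) R :=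
  aeval (fun i => ∑ j : Fin 3, C (M i j) * X j) q

/-- The quartic form `q_ε = (x−y)⁴ + (x−z)⁴ + (y−εz)⁴ − (x⁴ + y⁴ + z⁴)`. -/
def qeps {k : Type*} [CommRing k] (ε : k) : MvPolynomial (Fin 3) k :=
  (X 0 - X 1) ^ 4 + (X 0 - X 2) ^ 4 + (X 1 - C ε * X 2) ^ 4
    - (X 0 ^ 4 + X 1 ^ 4 + X 2 ^ 4)

/-! ### Weak Bezout -/

lemma elim_aux {B : Type*} [CommRing B] [IsDomain B] [UniqueFactorizationMonoid B]
    (f g : Polynomial B) (hf : Irreducible f) (hfg : ¬ f ∣ g) :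
    ∃ d : B, d ≠ 0 ∧ ∃ a b : Polynomial B, f * a + g * b = Polynomial.C d := by
  by_cases h0 : f.natDegree = 0
  · refine ⟨f.coeff 0, ?_, 1, 0, ?_⟩
    · intro h
      apply hf.ne_zero
      rw [Polynomial.eq_C_of_natDegree_eq_zero h0, h, map_zero]
    · rw [mul_one, mul_zero, add_zero]
      exact Polynomial.eq_C_of_natDegree_eq_zero h0
  · have hp := hf.isPrimitive h0
    have := Classical.arbitrary (NormalizedGCDMonoid B)
    let K := FractionRing B
    have hirr := (hp.irreducible_iff_irreducible_map_fraction_map (K := K)).1 hf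
    have hnd : ¬ f.map (algebraMap B K) ∣ g.map (algebraMap B K) :=
      fun h => hfg (hp.dvd_of_fraction_map_dvd_fraction_map h)
    have hcop : IsCoprime (f.map (algebraMap B K)) (g.map (algebraMap B K)) :=
      (hirr.coprime_iff_not_dvd).2 hnd
    have hres : Polynomial.resultant (f.map (algebraMap B K)) (g.map (algebraMap B K)) ≠ 0 := by
      rw [Ne, Polynomial.resultant_eq_zero_iff]
      tauto
    have hinj : Function.Injective (algebraMap B K) := IsFractionRing.injective B K
    rw [Polynomial.natDegree_map_eq_of_injective hinj, Polynomial.natDegree_map_eq_of_injective hinj,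
      Polynomial.resultant_map_map] at hres
    obtain ⟨a, b, -, -, hab⟩ := Polynomial.exists_mul_add_mul_eq_C_resultant
      (m := f.natDegree) (n := g.natDegree) f g le_rfl le_rfl (Or.inl h0)
    exact ⟨_, fun h => hres (by rw [h, map_zero]), a, b, hab⟩

lemma fse_rename {k : Type*} [Field k] (d : MvPolynomial (Fin 2) k) :
    finSuccEquiv k 2 (rename Fin.succ d) = Polynomial.C d := by
  have : ((finSuccEquiv k 2).toAlgHom.comp (rename Fin.succ)) =
      Polynomial.CAlgHom (R := k) (A := MvPolynomial (Fin 2) k) := by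
    apply MvPolynomial.algHom_ext
    intro i
    simp [finSuccEquiv_X_succ]
  exact congrArg (fun f => f d) this

lemma elim_zero {k : Type*} [Field k] (r F : MvPolynomial (Fin 3) k) (hr : Irreducible r)
    (hF : ¬ r ∣ F) :
    ∃ d : MvPolynomial (Fin 2) k, d ≠ 0 ∧ ∀ pt : Fin 3 → k, eval pt r = 0 → eval pt F = 0 →
      eval (fun i => pt (Fin.succ i)) d = 0 := by
  obtain ⟨d, hd, a, b, hab⟩ := elim_aux (finSuccEquiv k 2 r) (finSuccEquiv k 2 F)
    ((MulEquiv.irreducible_iff (finSuccEquiv k 2)).2 hr)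
    (fun h => hF ((map_dvd_iff (finSuccEquiv k 2)).1 h))
  refine ⟨d, hd, fun pt h1 h2 => ?_⟩
  have key : r * (finSuccEquiv k 2).symm a + F * (finSuccEquiv k 2).symm b
      = rename Fin.succ d := by
    apply (finSuccEquiv k 2).injective
    rw [map_add, map_mul, map_mul, AlgEquiv.apply_symm_apply, AlgEquiv.apply_symm_apply, hab,
      fse_rename]
  have := congrArg (eval pt) key
  rw [map_add, map_mul, map_mul, h1, h2, zero_mul, zero_mul, add_zero, eval_rename] at this
  exact this.symm

lemma ratio_finite {k : Type*} [Field k] [Infinite k] (r F : MvPolynomial (Fin 3) k)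
    (hr : Irreducible r) (hF : ¬ r ∣ F) (Z : Set (Fin 3 → k))
    (hZ : ∀ p ∈ Z, ∀ t : k, eval (t • p) r = 0 ∧ eval (t • p) F = 0) :
    {c : k | ∃ p ∈ Z, p 1 ≠ 0 ∧ c = p 2 / p 1}.Finite := by
  obtain ⟨d, hd, h⟩ := elim_zero r F hr hF
  by_contra hinf
  apply hd
  set S := {c : k | ∃ p ∈ Z, p 1 ≠ 0 ∧ c = p 2 / p 1} with hS
  have hv : ∀ t : k, ∀ c ∈ S, eval ![t, t * c] d = 0 := by
    rintro t c ⟨p, hp, hp1, rfl⟩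
    obtain ⟨h1, h2⟩ := hZ p hp (t / p 1)
    have := h _ h1 h2
    have hpt : (![t, t * (p 2 / p 1)] : Fin 2 → k) = fun i => ((t / p 1) • p) i.succ := by
      funext i
      fin_cases i
      · simp [hp1]
      · simp; ring
    rw [hpt]
    exact this
  have he : aeval (![X 0, X 0 * X 1] : Fin 2 → MvPolynomial (Fin 2) k) d = 0 := by
    apply funext_set (![Set.univ, S])
    · intro i
      fin_cases i
      · exact Set.infinite_univ
      · exact hinf
    · intro x hx
      have hx1 : x 1 ∈ S := hx 1 trivial
      have := hv (x 0) (x 1) hx1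
      rw [map_zero, ← this]
      rw [← MvPolynomial.coe_aeval_eq_eval, ← MvPolynomial.coe_aeval_eq_eval]
      simp only [RingHom.coe_coe]
      rw [← AlgHom.comp_apply, comp_aeval]
      congr 2
      funext i
      fin_cases i <;> simp
  apply funext_set (![{0}ᶜ, Set.univ])
  · intro i
    fin_cases i
    · exact (Set.finite_singleton 0).infinite_compl
    · exact Set.infinite_univ
  · intro x hx
    have hx0 : x 0 ≠ 0 := hx 0 trivial
    have := congrArg (eval ![x 0, x 1 / x 0]) he
    rw [map_zero] at this ⊢
    rw [← this]
    rw [← MvPolynomial.coe_aeval_eq_eval, ← MvPolynomial.coe_aeval_eq_eval]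
    simp only [RingHom.coe_coe]
    rw [← AlgHom.comp_apply, comp_aeval]
    congr 2
    funext i
    fin_cases i
    · simp
    · simp [mul_div_cancel₀ _ hx0]

lemma ratio_finite' {k : Type*} [Field k] [Infinite k] (r F : MvPolynomial (Fin 3) k)
    (hr : Irreducible r) (hF : ¬ r ∣ F) (Z : Set (Fin 3 → k))
    (hZ : ∀ p ∈ Z, ∀ t : k, eval (t • p) r = 0 ∧ eval (t • p) F = 0) (i j : Fin 3) :
    {c : k | ∃ p ∈ Z, p i ≠ 0 ∧ c = p j / p i}.Finite := by
  by_cases hij : i = j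
  · subst hij
    apply (Set.finite_singleton (1 : k)).subset
    rintro c ⟨p, -, h, rfl⟩
    simp [h]
  · obtain ⟨e, he1, he2⟩ : ∃ e : Equiv.Perm (Fin 3), e 1 = i ∧ e 2 = j := by
      revert i j; decide
    have := ratio_finite (rename e.symm r) (rename e.symm F)
      ((MulEquiv.irreducible_iff (renameEquiv k e.symm)).2 hr)
      (fun h => hF ((map_dvd_iff (renameEquiv k e.symm)).1 h))
      ((fun p => p ∘ e) '' Z) ?_
    · apply this.subset
      rintro c ⟨p, hp, h, rfl⟩
      exact ⟨p ∘ e, ⟨p, hp, rfl⟩, by simpa [he1] using h, by simp [he1, he2]⟩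
    · rintro _ ⟨p, hp, rfl⟩ t
      have hc : (t • (p ∘ e)) ∘ e.symm = t • p := by funext a; simp
      simp only [eval_rename, hc]
      exact hZ p hp t

lemma weak_bezout {k : Type*} [Field k] [Infinite k] (r F : MvPolynomial (Fin 3) k)
    (hr : Irreducible r) (hF : ¬ r ∣ F) (Z : Set (Projectivization k (Fin 3 → k)))
    (hZ : ∀ P ∈ Z, ∀ t : k, eval (t • P.rep) r = 0 ∧ eval (t • P.rep) F = 0) : Z.Finite := by
  have hcov : Z ⊆ ⋃ i : Fin 3, {P ∈ Z | P.rep i ≠ 0} := by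
    intro P hP
    have := P.rep_nonzero
    rw [Function.ne_iff] at this
    obtain ⟨i, hi⟩ := this
    exact Set.mem_iUnion.2 ⟨i, hP, hi⟩
  refine (Set.finite_iUnion fun i => ?_).subset hcov
  have hfin : ∀ j : Fin 3, {c : k | ∃ p ∈ Projectivization.rep '' Z, p i ≠ 0 ∧ c = p j / p i}.Finite :=
    fun j => ratio_finite' r F hr hF _ (by rintro _ ⟨P, hP, rfl⟩ t; exact hZ P hP t) i j
  have hpi := Set.Finite.pi (t := fun j : Fin 3 =>
    {c : k | ∃ p ∈ Projectivization.rep '' Z, p i ≠ 0 ∧ c = p j / p i}) hfin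
  apply Set.Finite.of_finite_image (f := fun P : Projectivization k (Fin 3 → k) =>
    fun j => P.rep j / P.rep i)
  · apply hpi.subset
    rintro _ ⟨P, ⟨hP, hPi⟩, rfl⟩ j -
    exact ⟨P.rep, ⟨P, hP, rfl⟩, hPi, rfl⟩
  · rintro P ⟨hP, hPi⟩ Q ⟨hQ, hQi⟩ h
    rw [← P.mk_rep, ← Q.mk_rep, Projectivization.mk_eq_mk_iff']
    refine ⟨P.rep i / Q.rep i, ?_⟩
    funext j
    have := congrFun h j
    simp only at this
    field_simp at this
    simp only [Pi.smul_apply, smul_eq_mul]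
    field_simp
    linear_combination -this

/-! ### Factors of homogeneous polynomials -/

lemma homog_aeval {k A : Type*} [Field k] [CommRing A] [Algebra k A] {n : ℕ}
    {F : MvPolynomial (Fin 3) k} (hF : F.IsHomogeneous n) (t : A) (p : Fin 3 → A) :
    aeval (fun i => t * p i) F = t ^ n * aeval p F := by
  rw [aeval_def, aeval_def, eval₂_eq', eval₂_eq', Finset.mul_sum]
  refine Finset.sum_congr rfl fun m hm => ?_
  have hd : ∑ i, m i = n := by
    have := hF (mem_support_iff.1 hm)
    rwa [Finsupp.weight_apply, Finsupp.sum_fintype _ _ (by simp), Finset.sum_congr rfl (g := m)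
      (by simp)] at this
  rw [← hd, ← Finset.prod_pow_eq_pow_sum]
  simp only [mul_pow, Finset.prod_mul_distrib]
  ring

lemma homog_scale {k : Type*} [Field k] {n : ℕ} {F : MvPolynomial (Fin 3) k}
    (hF : F.IsHomogeneous n) (t : k) (p : Fin 3 → k) :
    eval (t • p) F = t ^ n * eval p F :=
  homog_aeval hF t p

def scaleHom (k : Type*) [Field k] :
    MvPolynomial (Fin 3) k →ₐ[k] Polynomial (MvPolynomial (Fin 3) k) :=
  aeval (fun i => Polynomial.X * Polynomial.C (X i))

lemma scaleHom_homog {k : Type*} [Field k] {n : ℕ} {F : MvPolynomial (Fin 3) k}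
    (hF : F.IsHomogeneous n) :
    scaleHom k F = Polynomial.X ^ n * Polynomial.C F := by
  have h1 : (Polynomial.C F : Polynomial (MvPolynomial (Fin 3) k))
      = aeval (fun i => Polynomial.C (X i)) F := by
    have : (Polynomial.CAlgHom (R := k) (A := MvPolynomial (Fin 3) k)) =
        aeval (fun i => Polynomial.C (X i)) := by
      ext i; simp
    exact congrArg (fun f => f F) this
  rw [h1, scaleHom, homog_aeval hF]

lemma scaleHom_coeff {k : Type*} [Field k] (F : MvPolynomial (Fin 3) k) (n : ℕ) :
    (scaleHom k F).coeff n = homogeneousComponent n F := by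
  have h2 : scaleHom k F = ∑ i ∈ Finset.range (F.totalDegree + 1),
      Polynomial.X ^ i * Polynomial.C (homogeneousComponent i F) := by
    conv_lhs => rw [← sum_homogeneousComponent F, map_sum]
    exact Finset.sum_congr rfl fun i _ => scaleHom_homog (homogeneousComponent_isHomogeneous i F)
  rw [h2, Polynomial.finsetSum_coeff]
  simp only [Polynomial.coeff_X_pow_mul', Polynomial.coeff_C]
  by_cases hn : n < F.totalDegree + 1
  · rw [Finset.sum_eq_single n]
    · simp
    · intro b _ hb
      split_ifs with h1 h2
      · omega
      · rfl
      · rfl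
    · intro h; simp at h; omega
  · rw [homogeneousComponent_eq_zero _ _ (by omega)]
    apply Finset.sum_eq_zero
    intro b hb
    have := Finset.mem_range.1 hb
    split_ifs with h1 h2
    · omega
    · rfl
    · rfl

lemma homog_of_mul {k : Type*} [Field k] {n : ℕ} {r s : MvPolynomial (Fin 3) k}
    (h0 : r * s ≠ 0) (h : (r * s).IsHomogeneous n) : ∃ i, i ≤ n ∧ r.IsHomogeneous i := by
  have h1 := scaleHom_homog h
  rw [map_mul] at h1
  have hr0 : scaleHom k r ≠ 0 := by
    intro h'
    rw [h', zero_mul, eq_comm, mul_eq_zero, Polynomial.C_eq_zero] at h1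
    exact h1.elim (pow_ne_zero _ Polynomial.X_ne_zero) h0
  have hs0 : scaleHom k s ≠ 0 := by
    intro h'
    rw [h', mul_zero, eq_comm, mul_eq_zero, Polynomial.C_eq_zero] at h1
    exact h1.elim (pow_ne_zero _ Polynomial.X_ne_zero) h0
  have hd := congrArg Polynomial.natDegree h1
  have ht := congrArg Polynomial.natTrailingDegree h1
  rw [Polynomial.natDegree_mul hr0 hs0, mul_comm (Polynomial.X ^ n),
    Polynomial.natDegree_C_mul_X_pow _ _ h0] at hd
  rw [Polynomial.natTrailingDegree_mul hr0 hs0, mul_comm (Polynomial.X ^ n),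
    Polynomial.natTrailingDegree_mul_X_pow (by simpa using h0),
    Polynomial.natTrailingDegree_C] at ht
  have e1 := Polynomial.natTrailingDegree_le_natDegree (scaleHom k r)
  have e2 := Polynomial.natTrailingDegree_le_natDegree (scaleHom k s)
  refine ⟨(scaleHom k r).natDegree, by omega, ?_⟩
  have hrc : r = homogeneousComponent (scaleHom k r).natDegree r := by
    conv_lhs => rw [← sum_homogeneousComponent r]
    simp only [← scaleHom_coeff]
    apply Finset.sum_eq_single
    · intro b _ hb
      rcases lt_or_gt_of_ne hb with hb | hb
      · exact Polynomial.coeff_eq_zero_of_lt_natTrailingDegree (by omega)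
      · exact Polynomial.coeff_eq_zero_of_natDegree_lt hb
    · intro hb
      rw [scaleHom_coeff]
      apply homogeneousComponent_eq_zero
      simpa using hb
  have hh := homogeneousComponent_isHomogeneous (scaleHom k r).natDegree r
  rwa [← hrc] at hh

/-! ### Linear divisors -/

/-- the linear form `d 0 x + d 1 y + d 2 z` -/
def linForm {k : Type*} [Field k] (d : Fin 3 → k) : MvPolynomial (Fin 3) k :=
  ∑ i, C (d i) * X i

lemma eval_linForm {k : Type*} [Field k] (d v : Fin 3 → k) : eval v (linForm d) = dot3 d v := by
  simp [linForm, dot3, Fin.sum_univ_three]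

lemma linForm_dvd {k : Type*} [Field k] [Infinite k] (d : Fin 3 → k) (hd : d ≠ 0)
    (F : MvPolynomial (Fin 3) k) (h : ∀ v, dot3 d v = 0 → eval v F = 0) : linForm d ∣ F := by
  obtain ⟨i, hi⟩ := Function.ne_iff.1 hd
  simp only [Pi.zero_apply] at hi
  let φ : MvPolynomial (Fin 3) k →ₐ[k] MvPolynomial (Fin 3) k :=
    aeval (fun j => X j - linForm d * C (if j = i then (d i)⁻¹ else 0))
  have h0 : φ F = 0 := by
    apply MvPolynomial.funext
    intro x
    rw [map_zero]
    have : eval x (φ F) = eval (fun j => x j - dot3 d x * (if j = i then (d i)⁻¹ else 0)) F := by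
      simp only [φ]
      rw [← MvPolynomial.coe_aeval_eq_eval, ← MvPolynomial.coe_aeval_eq_eval]
      simp only [RingHom.coe_coe]
      rw [← AlgHom.comp_apply, comp_aeval]
      congr 2
      funext j
      change eval x _ = _
      simp only [map_sub, map_mul, eval_X, eval_C, eval_linForm]
    rw [this]
    apply h
    have hsum : d i * (d i)⁻¹ = 1 := mul_inv_cancel₀ hi
    simp only [dot3]
    fin_cases i <;> simp at hsum ⊢ <;> linear_combination (- (d 0 * x 0 + d 1 * x 1 + d 2 * x 2)) * hsum
  have h1 : (Ideal.Quotient.mkₐ k (Ideal.span {linForm d})).comp φ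
      = Ideal.Quotient.mkₐ k (Ideal.span {linForm d}) := by
    apply MvPolynomial.algHom_ext
    intro j
    simp only [φ, AlgHom.comp_apply, aeval_X, Ideal.Quotient.mkₐ_eq_mk]
    rw [Ideal.Quotient.mk_eq_mk_iff_sub_mem, Ideal.mem_span_singleton]
    exact ⟨-C (if j = i then (d i)⁻¹ else 0), by ring⟩
  have h2 := congrArg (fun f => f F) h1
  simp only [AlgHom.comp_apply, h0, map_zero] at h2
  rw [← Ideal.mem_span_singleton, ← Ideal.Quotient.eq_zero_iff_mem]
  exact h2.symm

lemma finite_lines {k : Type*} [Field k] [Infinite k] (F : MvPolynomial (Fin 3) k) (hF : F ≠ 0) :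
    {P : Projectivization k (Fin 3 → k) | ∀ v, dot3 P.rep v = 0 → eval v F = 0}.Finite := by
  have hfin : Finite {x : Associates (MvPolynomial (Fin 3) k) // x ∣ Associates.mk F} :=
    @Finite.of_fintype _ (UniqueFactorizationMonoid.fintypeSubtypeDvd _
      (Associates.mk_ne_zero.2 hF))
  have hfin' : {x : Associates (MvPolynomial (Fin 3) k) | x ∣ Associates.mk F}.Finite := hfin
  apply Set.Finite.of_finite_image (f := fun P : Projectivization k (Fin 3 → k) =>
    Associates.mk (linForm P.rep))
  · apply hfin'.subset
    rintro _ ⟨P, hP, rfl⟩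
    exact Associates.mk_dvd_mk.2 (linForm_dvd _ P.rep_nonzero _ hP)
  · intro P _ Q _ h
    obtain ⟨u, hu⟩ := Associates.mk_eq_mk_iff_associated.1 h
    obtain ⟨c, hc, hcu⟩ := MvPolynomial.isUnit_iff_eq_C_of_isReduced.1 u.isUnit
    rw [eq_comm, ← P.mk_rep, ← Q.mk_rep, Projectivization.mk_eq_mk_iff']
    refine ⟨c, ?_⟩
    funext j
    have := congrArg (eval (Pi.single j 1)) hu
    rw [hcu, map_mul, eval_linForm, eval_linForm, eval_C] at this
    simp only [dot3] at this
    fin_cases j <;> simp at this ⊢ <;> linear_combination this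

/-! ### Binary quartics -/

lemma coeff_binQuartic {R : Type*} [CommRing R] (f : Fin 5 → R) (m : Fin 2 →₀ ℕ) :
    coeff m (binQuartic f) = ∑ i : Fin 5,
      if Finsupp.single 0 (4 - (i : ℕ)) + Finsupp.single 1 (i : ℕ) = m then f i else 0 := by
  rw [binQuartic, coeff_sum]
  refine Finset.sum_congr rfl fun i _ => ?_
  rw [mul_assoc, coeff_C_mul, X_pow_eq_monomial, X_pow_eq_monomial, monomial_mul, coeff_monomial]
  simp

lemma binCoeff_binQuartic {R : Type*} [CommRing R] (f : Fin 5 → R) (j : Fin 5) :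
    binCoeff (binQuartic f) j = f j := by
  rw [binCoeff, coeff_binQuartic, Finset.sum_eq_single j]
  · simp
  · intro i _ hij
    rw [if_neg]
    intro h
    have := DFunLike.congr_fun h 1
    simp at this
    exact hij (Fin.ext this)
  · simp

lemma eq_binQuartic {R : Type*} [CommRing R] (g : MvPolynomial (Fin 2) R)
    (hg : g.IsHomogeneous 4) : g = binQuartic (binCoeff g) := by
  ext m
  rw [coeff_binQuartic]
  by_cases hm : m 0 + m 1 = 4
  · have h5 : m 1 < 5 := by omega
    rw [Finset.sum_eq_single ⟨m 1, h5⟩]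
    · have : Finsupp.single 0 (4 - m 1) + Finsupp.single 1 (m 1) = m := by
        ext i
        fin_cases i
        · simp; omega
        · simp
      simp only [binCoeff, this, if_true]
    · intro i _ hi
      rw [if_neg]
      intro h
      have := DFunLike.congr_fun h 1
      simp at this
      exact hi (Fin.ext this)
    · simp
  · rw [hg.coeff_eq_zero, Finset.sum_eq_zero]
    · intro i _
      rw [if_neg]
      rintro rfl
      apply hm
      simp
      omega
    · rw [Finsupp.degree_eq_sum, Fin.sum_univ_two]
      exact hm

section restr

variable {k : Type*} [Field k] {R : Type*} [CommRing R] [Algebra k R]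

def restr (q : MvPolynomial (Fin 3) k) (a b : Fin 3 → R) : MvPolynomial (Fin 2) R :=
  aeval (fun i => C (a i) * X 0 + C (b i) * X 1) q

def co (q : MvPolynomial (Fin 3) k) (a b : Fin 3 → R) : Fin 5 → R := binCoeff (restr q a b)

lemma restr_eq {q : MvPolynomial (Fin 3) k} (hq : q.IsHomogeneous 4) (a b : Fin 3 → R) :
    restr q a b = binQuartic (co q a b) := by
  apply eq_binQuartic
  have := hq.aeval (n := 1) (fun i => (C (a i) * X 0 + C (b i) * X 1 : MvPolynomial (Fin 2) R))
    (fun i => (isHomogeneous_C_mul_X _ _).add (isHomogeneous_C_mul_X _ _))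
  rw [one_mul] at this
  exact this

lemma aeval_restr (q : MvPolynomial (Fin 3) k) (a b : Fin 3 → R)
    {A : Type*} [CommRing A] [Algebra R A] [Algebra k A] [IsScalarTower k R A] (s t : A) :
    aeval ![s, t] (restr q a b) =
      aeval (fun i => algebraMap R A (a i) * s + algebraMap R A (b i) * t) q := by
  have : ((aeval ![s, t] : MvPolynomial (Fin 2) R →ₐ[R] A).restrictScalars k).comp
      (aeval (fun i => C (a i) * X 0 + C (b i) * X 1)) =
      aeval (fun i => algebraMap R A (a i) * s + algebraMap R A (b i) * t) := by
    apply MvPolynomial.algHom_ext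
    intro i
    simp
  exact congrArg (fun f => f q) this

lemma aeval_binQuartic (f : Fin 5 → R) {A : Type*} [CommRing A] [Algebra R A] (s t : A) :
    aeval ![s, t] (binQuartic f) = algebraMap R A (f 0) * s ^ 4 + algebraMap R A (f 1) * s ^ 3 * t
      + algebraMap R A (f 2) * s ^ 2 * t ^ 2 + algebraMap R A (f 3) * s * t ^ 3
      + algebraMap R A (f 4) * t ^ 4 := by
  simp [binQuartic, Fin.sum_univ_five]

lemma aeval_line {q : MvPolynomial (Fin 3) k} (hq : q.IsHomogeneous 4) (a b : Fin 3 → R)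
    {A : Type*} [CommRing A] [Algebra R A] [Algebra k A] [IsScalarTower k R A] (s t : A) :
    aeval (fun i => algebraMap R A (a i) * s + algebraMap R A (b i) * t) q =
      algebraMap R A (co q a b 0) * s ^ 4 + algebraMap R A (co q a b 1) * s ^ 3 * t
      + algebraMap R A (co q a b 2) * s ^ 2 * t ^ 2 + algebraMap R A (co q a b 3) * s * t ^ 3
      + algebraMap R A (co q a b 4) * t ^ 4 := by
  rw [← aeval_binQuartic, ← restr_eq hq, aeval_restr]

lemma binQuartic_eq_aeval (f : Fin 5 → R) :
    binQuartic f = C (f 0) * X 0 ^ 4 + C (f 1) * X 0 ^ 3 * X 1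
      + C (f 2) * X 0 ^ 2 * X 1 ^ 2 + C (f 3) * X 0 * X 1 ^ 3
      + C (f 4) * X 1 ^ 4 := by
  simp [binQuartic, Fin.sum_univ_five]

/-- coefficients after a linear substitution -/
def subCo (f : Fin 5 → R) (x y z w : R) : Fin 5 → R :=
  ![f 0 * x ^ 4 + f 1 * x ^ 3 * z + f 2 * x ^ 2 * z ^ 2 + f 3 * x * z ^ 3 + f 4 * z ^ 4,
    4 * f 0 * x ^ 3 * y + f 1 * (3 * x ^ 2 * y * z + x ^ 3 * w)
      + f 2 * (2 * x * y * z ^ 2 + 2 * x ^ 2 * z * w) + f 3 * (y * z ^ 3 + 3 * x * z ^ 2 * w)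
      + 4 * f 4 * z ^ 3 * w,
    6 * f 0 * x ^ 2 * y ^ 2 + f 1 * (3 * x * y ^ 2 * z + 3 * x ^ 2 * y * w)
      + f 2 * (y ^ 2 * z ^ 2 + 4 * x * y * z * w + x ^ 2 * w ^ 2)
      + f 3 * (3 * y * z ^ 2 * w + 3 * x * z * w ^ 2) + 6 * f 4 * z ^ 2 * w ^ 2,
    4 * f 0 * x * y ^ 3 + f 1 * (y ^ 3 * z + 3 * x * y ^ 2 * w)
      + f 2 * (2 * y ^ 2 * z * w + 2 * x * y * w ^ 2) + f 3 * (3 * y * z * w ^ 2 + x * w ^ 3)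
      + 4 * f 4 * z * w ^ 3,
    f 0 * y ^ 4 + f 1 * y ^ 3 * w + f 2 * y ^ 2 * w ^ 2 + f 3 * y * w ^ 3 + f 4 * w ^ 4]

lemma co_sub {q : MvPolynomial (Fin 3) k} (hq : q.IsHomogeneous 4) (a b : Fin 3 → R)
    (x y z w : R) :
    co q (x • a + z • b) (y • a + w • b) = subCo (co q a b) x y z w := by
  have h1 : restr q (x • a + z • b) (y • a + w • b) = binQuartic (subCo (co q a b) x y z w) := by
    have h2 := aeval_restr q a b (A := MvPolynomial (Fin 2) R) (C x * X 0 + C y * X 1)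
      (C z * X 0 + C w * X 1)
    have h3 : restr q (x • a + z • b) (y • a + w • b) =
        aeval (fun i => algebraMap R (MvPolynomial (Fin 2) R) (a i) * (C x * X 0 + C y * X 1) +
        algebraMap R (MvPolynomial (Fin 2) R) (b i) * (C z * X 0 + C w * X 1)) q := by
      rw [restr]
      congr 2
      funext i
      simp only [Pi.add_apply, Pi.smul_apply, smul_eq_mul, map_add, map_mul, algebraMap_eq]
      ring
    rw [h3, ← h2, restr_eq hq, aeval_binQuartic, binQuartic_eq_aeval]
    simp only [subCo, algebraMap_eq]
    simp only [Matrix.cons_val, map_add, map_mul, map_pow, map_ofNat]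
    ring
  rw [co, h1]
  funext i
  rw [binCoeff_binQuartic]

lemma Sinv_sub (f : Fin 5 → R) (x y z w : R) :
    Sinv (subCo f x y z w) = (x * w - y * z) ^ 4 * Sinv f := by
  simp only [Sinv, subCo, Matrix.cons_val]
  ring

lemma Tinv_sub (f : Fin 5 → R) (x y z w : R) :
    Tinv (subCo f x y z w) = (x * w - y * z) ^ 6 * Tinv f := by
  simp only [Tinv, subCo, Matrix.cons_val]
  ring

lemma co_map (q : MvPolynomial (Fin 3) k) (a b : Fin 3 → R)
    {A : Type*} [CommRing A] [Algebra k A] (φ : R →ₐ[k] A) (i : Fin 5) :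
    co q (fun j => φ (a j)) (fun j => φ (b j)) i = φ (co q a b i) := by
  have : restr q (fun j => φ (a j)) (fun j => φ (b j)) = map φ.toRingHom (restr q a b) := by
    have h : (aeval (fun i => C (φ (a i)) * X 0 + C (φ (b i)) * X 1) :
        MvPolynomial (Fin 3) k →ₐ[k] MvPolynomial (Fin 2) A) =
        (mapAlgHom φ).comp (aeval (fun i => C (a i) * X 0 + C (b i) * X 1)) := by
      apply MvPolynomial.algHom_ext
      intro i
      simp
    exact congrArg (fun f => f q) h
  rw [co, this, binCoeff, coeff_map]
  rfl

end restr

/-- The normal form of an inflection line. -/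
lemma triple_root_aux {k : Type*} [Field k] (h6 : (6 : k) ≠ 0)
    {q : MvPolynomial (Fin 3) k} (hq : q.IsHomogeneous 4) (a b : Fin 3 → k)
    (h0 : co q a b 0 = 0) (hS : Sinv (co q a b) = 0) (hT : Tinv (co q a b) = 0) :
    ∃ x y z w : k, x * w - y * z ≠ 0 ∧
      co q (x • a + z • b) (y • a + w • b) 0 = 0 ∧
      co q (x • a + z • b) (y • a + w • b) 1 = 0 ∧
      co q (x • a + z • b) (y • a + w • b) 2 = 0 := by
  have h3 : (3 : k) ≠ 0 := fun h => h6 (by linear_combination 2 * h)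
  simp only [co_sub hq]
  set f := co q a b
  · by_cases h1 : f 1 = 0
    · refine ⟨1, 0, 0, 1, by simp, ?_⟩
      simp only [Sinv, h0, h1] at hS
      have h2 : f 2 = 0 := by simpa using hS
      simp [subCo, h0, h1, h2]
    · refine ⟨- f 2, 1, 3 * f 1, 0, by simp [h1, h3], ?_⟩
      simp only [Sinv, Tinv, h0] at hS hT
      have e3 : 3 * f 1 * f 3 = f 2 ^ 2 := by linear_combination -hS
      have e4 : 27 * f 1 ^ 2 * f 4 = f 2 ^ 3 := by linear_combination -hT + 3 * f 2 * e3
      simp only [subCo, Matrix.cons_val, h0]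
      refine ⟨?_, ?_, ?_⟩
      · linear_combination (-9 * f 1 ^ 2 * f 2) * e3 + 3 * f 1 ^ 2 * e4
      · linear_combination (9 * f 1 ^ 2) * e3
      · ring

lemma triple_root {k : Type*} [Field k] [IsAlgClosed k] (h6 : (6 : k) ≠ 0)
    {q : MvPolynomial (Fin 3) k} (hq : q.IsHomogeneous 4) (a b : Fin 3 → k)
    (hS : Sinv (co q a b) = 0) (hT : Tinv (co q a b) = 0) :
    ∃ x y z w : k, x * w - y * z ≠ 0 ∧
      co q (x • a + z • b) (y • a + w • b) 0 = 0 ∧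
      co q (x • a + z • b) (y • a + w • b) 1 = 0 ∧
      co q (x • a + z • b) (y • a + w • b) 2 = 0 := by
  by_cases h0 : co q a b 0 = 0
  · exact triple_root_aux h6 hq a b h0 hS hT
  · obtain ⟨x, hx⟩ : ∃ x : k, co q a b 0 * x ^ 4 + co q a b 1 * x ^ 3 + co q a b 2 * x ^ 2 + co q a b 3 * x + co q a b 4 = 0 := by
      let P : Polynomial k := Polynomial.C (co q a b 0) * Polynomial.X ^ 4
        + Polynomial.C (co q a b 1) * Polynomial.X ^ 3 + Polynomial.C (co q a b 2) * Polynomial.X ^ 2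
        + Polynomial.C (co q a b 3) * Polynomial.X + Polynomial.C (co q a b 4)
      have hP : P.degree ≠ 0 := by
        have : P.degree = 4 := by
          simp only [P]
          compute_degree!
        rw [this]; decide
      obtain ⟨x, hx⟩ := IsAlgClosed.exists_root P hP
      refine ⟨x, ?_⟩
      simpa [P, Polynomial.IsRoot] using hx
    obtain ⟨x', y', z', w', hd, e0, e1, e2⟩ := triple_root_aux h6 hq (x • a + (1 : k) • b)
      ((1 : k) • a + (0 : k) • b)
      (by rw [co_sub hq]; simp only [subCo, Matrix.cons_val]; linear_combination hx)
      (by rw [co_sub hq, Sinv_sub, hS, mul_zero]) (by rw [co_sub hq, Tinv_sub, hT, mul_zero])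
    have v1 : x' • (x • a + (1 : k) • b) + z' • ((1 : k) • a + (0 : k) • b)
        = (x' * x + z') • a + x' • b := by module
    have v2 : y' • (x • a + (1 : k) • b) + w' • ((1 : k) • a + (0 : k) • b)
        = (y' * x + w') • a + y' • b := by module
    rw [v1, v2] at e0 e1 e2
    refine ⟨x' * x + z', y' * x + w', x', y', ?_, e0, e1, e2⟩
    intro h
    apply hd
    linear_combination -h

/-! ### From the invariants to inflection points -/

lemma chain_rule {k : Type*} [Field k] (φ : Fin 3 → Polynomial k) (q : MvPolynomial (Fin 3) k) :
    Polynomial.derivative (aeval φ q) =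
      ∑ i, aeval φ (pderiv i q) * Polynomial.derivative (φ i) := by
  induction q using MvPolynomial.induction_on with
  | C a => simp
  | add p q hp hq => simp only [map_add, hp, hq, add_mul, Finset.sum_add_distrib]
  | mul_X p n hp =>
    have hpd : ∀ i, pderiv i (p * X n) = pderiv i p * X n + p * pderiv i (X n) :=
      fun i => pderiv_mul
    rw [map_mul, Polynomial.derivative_mul, hp, aeval_X]
    simp only [hpd, Fin.sum_univ_three, map_add, map_mul, aeval_X]
    fin_cases n <;> simp [pderiv_X] <;> ring

lemma line_derivs {k : Type*} [Field k] {q : MvPolynomial (Fin 3) k} (hq : q.IsHomogeneous 4)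
    (p b : Fin 3 → k) (h0 : co q p b 0 = 0) (h1 : co q p b 1 = 0) (h2 : co q p b 2 = 0) :
    eval p q = 0 ∧ ∑ i, eval p (pderiv i q) * b i = 0 ∧
      ∑ i, ∑ j, eval p (pderiv j (pderiv i q)) * b j * b i = 0 := by
  have hline := aeval_line hq p b (A := Polynomial k) 1 Polynomial.X
  set φ : Fin 3 → Polynomial k := fun i =>
    algebraMap k (Polynomial k) (p i) * 1 + algebraMap k (Polynomial k) (b i) * Polynomial.X with hφ
  have hev : ∀ F : MvPolynomial (Fin 3) k, (aeval φ F).eval 0 = eval p F := by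
    intro F
    have : (Polynomial.aeval (0 : k)).comp (aeval φ) = (aeval p : MvPolynomial (Fin 3) k →ₐ[k] k) := by
      apply MvPolynomial.algHom_ext
      intro i
      simp [hφ]
    have := congrArg (fun f => f F) this
    simpa [MvPolynomial.coe_aeval_eq_eval] using this
  have hφ' : ∀ i, Polynomial.derivative (φ i) = Polynomial.C (b i) := by
    intro i; simp [hφ]
  have hd1 := congrArg Polynomial.derivative hline
  have hd2 := congrArg Polynomial.derivative hd1
  rw [chain_rule] at hd1
  rw [chain_rule] at hd2
  simp only [h0, h1, h2, map_zero, zero_mul, zero_add, one_pow, mul_one, hφ', map_sum,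
    Polynomial.derivative_mul, chain_rule, Polynomial.derivative_C, mul_zero, add_zero] at hd1 hd2
  refine ⟨?_, ?_, ?_⟩
  · rw [← hev, hline]; simp [h0]
  · have := congrArg (Polynomial.eval 0) hd1
    rw [Polynomial.eval_finsetSum] at this
    simpa [hev] using this
  · have := congrArg (Polynomial.eval 0) hd2
    rw [Polynomial.eval_finsetSum] at this
    simpa [hev, Polynomial.eval_finsetSum, Finset.sum_mul] using this

/-- `p` is a point at which the line with coordinates `d` meets `q = 0` with multiplicity `≥ 3` -/
def InfPt {k : Type*} [Field k] (q : MvPolynomial (Fin 3) k) (d p : Fin 3 → k) : Prop :=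
  dot3 d p = 0 ∧ eval p q = 0 ∧ ∀ v, dot3 d v = 0 →
    ∑ i, eval p (pderiv i q) * v i = 0 ∧
      ∑ i, ∑ j, eval p (pderiv j (pderiv i q)) * v j * v i = 0

lemma euler_eval {k : Type*} [Field k] {n : ℕ} {F : MvPolynomial (Fin 3) k}
    (hF : F.IsHomogeneous n) (p : Fin 3 → k) :
    ∑ i, eval p (pderiv i F) * p i = n * eval p F := by
  have := congrArg (eval p) hF.sum_X_mul_pderiv
  simpa [mul_comm] using this

lemma pderiv_comm' {k : Type*} [Field k] (F : MvPolynomial (Fin 3) k) (i j : Fin 3) :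
    pderiv i (pderiv j F) = pderiv j (pderiv i F) := by
  ext m
  simp only [coeff_pderiv]
  by_cases h : i = j
  · subst h; rfl
  · rw [add_right_comm]
    simp [h, Ne.symm h]
    ring

lemma infPt_of_basis {k : Type*} [Field k] {q : MvPolynomial (Fin 3) k} (hq : q.IsHomogeneous 4)
    (d p b : Fin 3 → k) (hp : dot3 d p = 0)
    (hspan : ∀ v, dot3 d v = 0 → ∃ s t : k, v = s • p + t • b)
    (h0 : co q p b 0 = 0) (h1 : co q p b 1 = 0) (h2 : co q p b 2 = 0) : InfPt q d p := by
  obtain ⟨e0, e1, e2⟩ := line_derivs hq p b h0 h1 h2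
  refine ⟨hp, e0, fun v hv => ?_⟩
  obtain ⟨s, t, rfl⟩ := hspan v hv
  have E := euler_eval hq p
  have Ei := fun i => euler_eval (hq.pderiv (i := i)) p
  have c01 := pderiv_comm' q 0 1
  have c02 := pderiv_comm' q 0 2
  have c12 := pderiv_comm' q 1 2
  rw [e0] at E
  have E0 := Ei 0
  have E1 := Ei 1
  have E2 := Ei 2
  simp only [Fin.sum_univ_three, c01, c02, c12] at E E0 E1 E2 e1 e2 ⊢
  norm_num at E E0 E1 E2
  simp only [Pi.add_apply, Pi.smul_apply, smul_eq_mul]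
  constructor
  · linear_combination s * E + t * e1
  · linear_combination t ^ 2 * e2 + s ^ 2 * (p 0 * E0 + p 1 * E1 + p 2 * E2 + 3 * E)
      + 2 * s * t * (b 0 * E0 + b 1 * E1 + b 2 * E2 + 3 * e1)

lemma infPt_of_ST {k : Type*} [Field k] [IsAlgClosed k] (h6 : (6 : k) ≠ 0)
    {q : MvPolynomial (Fin 3) k} (hq : q.IsHomogeneous 4) (d a b : Fin 3 → k)
    (ha : dot3 d a = 0) (hb : dot3 d b = 0)
    (hspan : ∀ v, dot3 d v = 0 → ∃ s t : k, v = s • a + t • b)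
    (hind : ∀ s t : k, s • a + t • b = 0 → s = 0 ∧ t = 0)
    (hS : Sinv (co q a b) = 0) (hT : Tinv (co q a b) = 0) :
    ∃ p, p ≠ 0 ∧ InfPt q d p := by
  obtain ⟨x, y, z, w, hd, h0, h1, h2⟩ := triple_root h6 hq a b hS hT
  refine ⟨x • a + z • b, ?_, infPt_of_basis hq d _ (y • a + w • b) ?_ ?_ h0 h1 h2⟩
  · intro h
    obtain ⟨rfl, rfl⟩ := hind _ _ h
    simp at hd
  · simp only [dot3, Pi.add_apply, Pi.smul_apply, smul_eq_mul] at ha hb ⊢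
    linear_combination x * ha + z * hb
  · intro v hv
    obtain ⟨s, t, rfl⟩ := hspan v hv
    refine ⟨(s * w - t * y) * (x * w - y * z)⁻¹, (t * x - s * z) * (x * w - y * z)⁻¹, ?_⟩
    have hinv := mul_inv_cancel₀ hd
    funext i
    simp only [Pi.add_apply, Pi.smul_apply, smul_eq_mul]
    linear_combination -(s * a i + t * b i) * hinv

section HK

variable {k : Type*} [Field k]

lemma gsub_eq (q : MvPolynomial (Fin 3) k) :
    gsub q = restr q (![-X 1, X 0, 0] : Fin 3 → MvPolynomial (Fin 3) k) ![-X 2, 0, X 0] := by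
  rw [gsub, restr]
  congr 2
  funext i
  fin_cases i
  · change C (-X 1) * X 0 - C (X 2) * X 1 = C (-X 1) * X 0 + C (-X 2) * X 1
    have h0 : (C (-X 2) + C (X 2) : MvPolynomial (Fin 2) (MvPolynomial (Fin 3) k)) = 0 := by
      rw [← C_add, neg_add_cancel, C_0]
    linear_combination (-X 1) * h0
  · simp
  · simp

lemma eval_co (q : MvPolynomial (Fin 3) k) (a b : Fin 3 → MvPolynomial (Fin 3) k)
    (d : Fin 3 → k) : (fun i => eval d (co q a b i)) =
      co q (fun j => eval d (a j)) (fun j => eval d (b j)) := by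
  funext i
  exact (co_map q a b (aeval d) i).symm

lemma eval_Sinv (f : Fin 5 → MvPolynomial (Fin 3) k) (d : Fin 3 → k) :
    eval d (Sinv f) = Sinv (fun i => eval d (f i)) := by
  simp [Sinv]

lemma eval_Tinv (f : Fin 5 → MvPolynomial (Fin 3) k) (d : Fin 3 → k) :
    eval d (Tinv f) = Tinv (fun i => eval d (f i)) := by
  simp [Tinv]

lemma co_change {q : MvPolynomial (Fin 3) k} (hq : q.IsHomogeneous 4) :
    subCo (co q (![-X 1, X 0, 0] : Fin 3 → MvPolynomial (Fin 3) k) ![0, X 2, -X 1]) 1 0 0 (X 0)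
    = subCo (co q (![-X 1, X 0, 0] : Fin 3 → MvPolynomial (Fin 3) k) ![-X 2, 0, X 0])
      1 (X 2) 0 (-X 1) := by
  rw [← co_sub hq, ← co_sub hq]
  congr 1
  funext i
  fin_cases i <;> simp <;> ring

lemma exists_infPt [IsAlgClosed k] (h6 : (6 : k) ≠ 0)
    {q : MvPolynomial (Fin 3) k} (hq : q.IsHomogeneous 4) (H K : MvPolynomial (Fin 3) k)
    (hH : X 0 ^ 4 * H = SG q) (hK : X 0 ^ 6 * K = TG q) (d : Fin 3 → k)
    (hd : d 0 ≠ 0 ∨ d 1 ≠ 0) (h1 : eval d H = 0) (h2 : eval d K = 0) :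
    ∃ p, p ≠ 0 ∧ InfPt q d p := by
  have hS : X 0 ^ 4 * H =
      Sinv (co q (![-X 1, X 0, 0] : Fin 3 → MvPolynomial (Fin 3) k) ![-X 2, 0, X 0]) := by
    rw [hH, SG, gsub_eq]; rfl
  have hT : X 0 ^ 6 * K =
      Tinv (co q (![-X 1, X 0, 0] : Fin 3 → MvPolynomial (Fin 3) k) ![-X 2, 0, X 0]) := by
    rw [hK, TG, gsub_eq]; rfl
  by_cases hd0 : d 0 = 0
  · have hd1 : d 1 ≠ 0 := by tauto
    have hS' : X 1 ^ 4 * H =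
        Sinv (co q (![-X 1, X 0, 0] : Fin 3 → MvPolynomial (Fin 3) k) ![0, X 2, -X 1]) := by
      have := congrArg Sinv (co_change hq)
      rw [Sinv_sub, Sinv_sub, ← hS] at this
      apply mul_left_cancel₀ (pow_ne_zero 4 (X_ne_zero (R := k) (0 : Fin 3)))
      linear_combination -this
    have hT' : X 1 ^ 6 * K =
        Tinv (co q (![-X 1, X 0, 0] : Fin 3 → MvPolynomial (Fin 3) k) ![0, X 2, -X 1]) := by
      have := congrArg Tinv (co_change hq)
      rw [Tinv_sub, Tinv_sub, ← hT] at this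
      apply mul_left_cancel₀ (pow_ne_zero 6 (X_ne_zero (R := k) (0 : Fin 3)))
      linear_combination -this
    have eS := congrArg (eval d) hS'
    have eT := congrArg (eval d) hT'
    rw [eval_Sinv, eval_co, map_mul, h1, mul_zero] at eS
    rw [eval_Tinv, eval_co, map_mul, h2, mul_zero] at eT
    refine infPt_of_ST h6 hq d _ _ ?_ ?_ ?_ ?_ eS.symm eT.symm
    · simp [dot3]; ring
    · simp [dot3]; ring
    · intro v hv
      refine ⟨- v 0 / d 1, - v 2 / d 1, ?_⟩
      simp only [dot3, hd0] at hv
      funext i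
      fin_cases i <;> simp [hd0]
      · field_simp
      · field_simp; linear_combination hv
      · field_simp
    · intro s t hst
      have e0 := congrFun hst 0
      have e2 := congrFun hst 2
      simp [hd1] at e0 e2
      exact ⟨e0, e2⟩
  · have eS := congrArg (eval d) hS
    have eT := congrArg (eval d) hT
    rw [eval_Sinv, eval_co, map_mul, h1, mul_zero] at eS
    rw [eval_Tinv, eval_co, map_mul, h2, mul_zero] at eT
    refine infPt_of_ST h6 hq d _ _ ?_ ?_ ?_ ?_ eS.symm eT.symm
    · simp [dot3]; ring
    · simp [dot3]; ring
    · intro v hv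
      refine ⟨v 1 / d 0, v 2 / d 0, ?_⟩
      simp only [dot3] at hv
      funext i
      fin_cases i <;> simp
      · field_simp; linear_combination hv
      · field_simp
      · field_simp
    · intro s t hst
      have e1 := congrFun hst 1
      have e2 := congrFun hst 2
      simp [hd0] at e1 e2
      exact ⟨e1, e2⟩

end HK

/-! ### The derivation argument -/

/-- the tangent vector field `e × ∇q` -/
def tau {k : Type*} [Field k] (q : MvPolynomial (Fin 3) k) (e : Fin 3 → k) :
    Fin 3 → MvPolynomial (Fin 3) k :=
  ![C (e 1) * pderiv 2 q - C (e 2) * pderiv 1 q, C (e 2) * pderiv 0 q - C (e 0) * pderiv 2 q,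
    C (e 0) * pderiv 1 q - C (e 1) * pderiv 0 q]

/-- the Hessian evaluated at the tangent field -/
def hessTau {k : Type*} [Field k] (q : MvPolynomial (Fin 3) k) (e : Fin 3 → k) :
    MvPolynomial (Fin 3) k :=
  ∑ i, ∑ j, tau q e j * tau q e i * pderiv j (pderiv i q)

lemma ideal_stable {k A : Type*} [Field k] [CommRing A] [Algebra k A] (D : Derivation k A A)
    (S : Set A) (h : ∀ x ∈ S, D x ∈ Ideal.span S) :
    ∀ x ∈ Ideal.span S, D x ∈ Ideal.span S := by
  intro x hx
  induction hx using Submodule.span_induction with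
  | mem x hx => exact h x hx
  | zero => simp
  | add x y _ _ hx hy => rw [map_add]; exact add_mem hx hy
  | smul a x hx hD =>
    rw [smul_eq_mul, Derivation.leibniz, smul_eq_mul, smul_eq_mul]
    exact add_mem (Ideal.mul_mem_left _ _ hD) (Ideal.mul_mem_right _ _ hx)

lemma stable_order {k : Type*} [Field k] (D : Derivation k (MvPolynomial (Fin 3) k)
    (MvPolynomial (Fin 3) k)) (J : Ideal (MvPolynomial (Fin 3) k)) (hJ : ∀ x ∈ J, D x ∈ J)
    (p : Fin 3 → k) (hp : ∀ x ∈ J, eval p x = 0) (β : MvPolynomial (Fin 3) k)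
    (hβ : eval p β = 0) (hDβ : eval p (D β) ≠ 0) (i : ℕ) :
    (∀ j : ℕ, 0 < j → j ≤ i → (j : k) ≠ 0) → ∀ U, β ^ i * U ∈ J → eval p U = 0 := by
  induction i with
  | zero => intro _ U hU; exact hp U (by simpa using hU)
  | succ i ih =>
    intro hc U hU
    have h1 := hJ _ hU
    have h2 : D (β ^ (i + 1) * U) = β ^ i * (((i + 1 : ℕ) : MvPolynomial (Fin 3) k) * D β * U
        + β * D U) := by
      rw [Derivation.leibniz, Derivation.leibniz_pow]
      simp only [smul_eq_mul, nsmul_eq_mul, Nat.add_sub_cancel]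
      ring
    rw [h2] at h1
    have h3 := ih (fun j hj hji => hc j hj (by omega)) _ h1
    have h4 := hc (i + 1) (by omega) le_rfl
    simp only [map_add, map_mul, map_natCast, hβ, zero_mul, add_zero] at h3
    rcases mul_eq_zero.1 h3 with h | h
    · exact absurd h (mul_ne_zero h4 hDβ)
    · exact h

lemma lemmaA {k : Type*} [Field k] [Infinite k] (h6 : (6 : k) ≠ 0)
    {q r s : MvPolynomial (Fin 3) k} (hq : q.IsHomogeneous 4) (hqr : q = r * s)
    (hr : Prime r) (hrs : ¬ r ∣ s) (e g p m : Fin 3 → k) (hG : r ∣ hessTau q e)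
    (hrp : eval p r = 0) (hm : ∀ i, m i = eval p (pderiv i q))
    (he : dot3 e p ≠ 0) (hg : dot3 m g ≠ 0) :
    ∀ v, dot3 m v = 0 → eval v q = 0 := by
  have h2 : (2 : k) ≠ 0 := fun h => h6 (by linear_combination 3 * h)
  have h3 : (3 : k) ≠ 0 := fun h => h6 (by linear_combination 2 * h)
  have h4 : (4 : k) ≠ 0 := fun h => mul_ne_zero h2 h2 (by linear_combination h)
  have hchar : ∀ i : ℕ, i ≤ 4 → ∀ j : ℕ, 0 < j → j ≤ i → (j : k) ≠ 0 := by
    intro i hi j hj hji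
    have : j ≤ 4 := hji.trans hi
    interval_cases j <;> norm_num <;> assumption
  have hmp : dot3 m p = 0 := by
    have := euler_eval hq p
    rw [hqr, map_mul, hrp, zero_mul, mul_zero, ← hqr, Fin.sum_univ_three] at this
    simpa [dot3, hm] using this
  -- the polynomials
  set n : Fin 3 → MvPolynomial (Fin 3) k := fun i => pderiv i q with hn
  set τ := tau q e with hτ
  have t0 : τ 0 = C (e 1) * n 2 - C (e 2) * n 1 := rfl
  have t1 : τ 1 = C (e 2) * n 0 - C (e 0) * n 2 := rfl
  have t2 : τ 2 = C (e 0) * n 1 - C (e 1) * n 0 := rfl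
  set α : MvPolynomial (Fin 3) k := linForm e with hα
  have hα' : α = C (e 0) * X 0 + C (e 1) * X 1 + C (e 2) * X 2 := by
    simp [hα, linForm, Fin.sum_univ_three]
  set N : MvPolynomial (Fin 3) k := C (g 0) * n 0 + C (g 1) * n 1 + C (g 2) * n 2 with hN
  set D : Derivation k (MvPolynomial (Fin 3) k) (MvPolynomial (Fin 3) k) :=
    (α * N) • (τ 0 • pderiv 0 + τ 1 • pderiv 1 + τ 2 • pderiv 2) with hD
  have Dap : ∀ F, D F = α * N * (τ 0 * pderiv 0 F + τ 1 * pderiv 1 F + τ 2 * pderiv 2 F) := by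
    intro F; simp [hD]; ring
  -- the derivatives of the gradient
  set h : Fin 3 → MvPolynomial (Fin 3) k := fun j =>
    τ 0 * pderiv 0 (n j) + τ 1 * pderiv 1 (n j) + τ 2 * pderiv 2 (n j) with hh
  have Dn : ∀ j, D (n j) = α * N * h j := fun j => Dap _
  have c10 : pderiv 1 (n 0) = pderiv 0 (n 1) := pderiv_comm' q 1 0
  have c20 : pderiv 2 (n 0) = pderiv 0 (n 2) := pderiv_comm' q 2 0
  have c21 : pderiv 2 (n 1) = pderiv 1 (n 2) := pderiv_comm' q 2 1
  have Eq : X 0 * n 0 + X 1 * n 1 + X 2 * n 2 = 4 * q := by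
    have := hq.sum_X_mul_pderiv
    simpa [Fin.sum_univ_three] using this
  have En : ∀ j, X 0 * pderiv 0 (n j) + X 1 * pderiv 1 (n j) + X 2 * pderiv 2 (n j) = 3 * n j := by
    intro j
    have := (hq.pderiv (i := j)).sum_X_mul_pderiv
    simpa [Fin.sum_univ_three] using this
  have hG' : hessTau q e = τ 0 * h 0 + τ 1 * h 1 + τ 2 * h 2 := by
    simp only [hessTau, Fin.sum_univ_three, hh, ← hτ]
    ring
  have hxh : X 0 * h 0 + X 1 * h 1 + X 2 * h 2 = 0 := by
    have E0 := En 0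
    have E1 := En 1
    have E2 := En 2
    rw [c10, c20] at E0
    rw [c21] at E1
    simp only [hh, c10, c20, c21]
    linear_combination τ 0 * E0 + τ 1 * E1 + τ 2 * E2 + 3 * n 0 * t0 + 3 * n 1 * t1
      + 3 * n 2 * t2
  obtain ⟨G, hGr⟩ := hG
  rw [hG'] at hGr
  rw [t0, t1, t2] at hGr
  -- `r` divides the minors of `(h, n)` up to `α`
  obtain ⟨K01, k01⟩ : r ∣ α * (h 0 * n 1 - h 1 * n 0) := by
    refine ⟨4 * s * (h 0 * C (e 1) - h 1 * C (e 0)) - X 2 * G, ?_⟩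
    linear_combination (h 0 * n 1 - h 1 * n 0) * hα' + (h 0 * C (e 1) - h 1 * C (e 0)) * Eq
      + 4 * (h 0 * C (e 1) - h 1 * C (e 0)) * hqr - X 2 * hGr
      + (C (e 0) * n 1 - C (e 1) * n 0) * hxh
  obtain ⟨K12, k12⟩ : r ∣ α * (h 1 * n 2 - h 2 * n 1) := by
    refine ⟨4 * s * (h 1 * C (e 2) - h 2 * C (e 1)) - X 0 * G, ?_⟩
    linear_combination (h 1 * n 2 - h 2 * n 1) * hα' + (h 1 * C (e 2) - h 2 * C (e 1)) * Eq
      + 4 * (h 1 * C (e 2) - h 2 * C (e 1)) * hqr - X 0 * hGr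
      + (C (e 1) * n 2 - C (e 2) * n 1) * hxh
  obtain ⟨K02, k02⟩ : r ∣ α * (h 0 * n 2 - h 2 * n 0) := by
    refine ⟨4 * s * (h 0 * C (e 2) - h 2 * C (e 0)) + X 1 * G, ?_⟩
    linear_combination (h 0 * n 2 - h 2 * n 0) * hα' + (h 0 * C (e 2) - h 2 * C (e 0)) * Eq
      + 4 * (h 0 * C (e 2) - h 2 * C (e 0)) * hqr + X 1 * hGr
      - (C (e 2) * n 0 - C (e 0) * n 2) * hxh
  -- `r` divides `D r`
  have hDr : r ∣ D r := by
    have hDq : D q = 0 := by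
      rw [Dap, t0, t1, t2]
      simp only [hn]
      ring
    rw [hqr, Derivation.leibniz, smul_eq_mul, smul_eq_mul] at hDq
    have : r ∣ s * D r := ⟨- D s, by linear_combination hDq⟩
    exact (hr.dvd_or_dvd this).resolve_left hrs
  set w01 := C (m 0) * n 1 - C (m 1) * n 0 with hw01
  set w02 := C (m 0) * n 2 - C (m 2) * n 0 with hw02
  set w12 := C (m 1) * n 2 - C (m 2) * n 1 with hw12
  set ℓ : MvPolynomial (Fin 3) k := linForm m with hℓ
  have hℓ' : ℓ = C (m 0) * X 0 + C (m 1) * X 1 + C (m 2) * X 2 := by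
    simp [hℓ, linForm, Fin.sum_univ_three]
  have DC : ∀ a : k, D (C a) = 0 := fun a => derivation_C D a
  have Dmul : ∀ (a : k) F, D (C a * F) = C a * D F := by
    intro a F
    rw [Derivation.leibniz, DC, smul_zero, add_zero, smul_eq_mul]
  have DX : ∀ i, D (X i) = α * N * τ i := by
    intro i
    rw [Dap]
    fin_cases i <;> simp [pderiv_X]
  set S : Set (MvPolynomial (Fin 3) k) := {r, ℓ, w01, w02, w12} with hS
  set J := Ideal.span S with hJ
  have mr : r ∈ J := Ideal.subset_span (by simp [hS])
  have mℓ : ℓ ∈ J := Ideal.subset_span (by simp [hS])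
  have m01 : w01 ∈ J := Ideal.subset_span (by simp [hS])
  have m02 : w02 ∈ J := Ideal.subset_span (by simp [hS])
  have m12 : w12 ∈ J := Ideal.subset_span (by simp [hS])
  set gh := C (g 0) * h 0 + C (g 1) * h 1 + C (g 2) * h 2 with hgh
  have hst : ∀ x ∈ J, D x ∈ J := by
    apply ideal_stable
    intro x hx
    simp only [hS, Set.mem_insert_iff, Set.mem_singleton_iff] at hx
    rcases hx with rfl | rfl | rfl | rfl | rfl
    · exact Ideal.mem_of_dvd _ hDr mr
    · have : D ℓ = (α * N * C (- e 2)) * w01 + (α * N * C (e 1)) * w02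
          + (α * N * C (- e 0)) * w12 := by
        rw [hℓ', map_add, map_add, Dmul, Dmul, Dmul, DX, DX, DX, t0, t1, t2, hw01, hw02, hw12,
          C_neg, C_neg]
        ring
      rw [this]
      exact add_mem (add_mem (J.mul_mem_left _ m01) (J.mul_mem_left _ m02)) (J.mul_mem_left _ m12)
    · have : D w01 = (α * gh) * w01 + (C (m 0) * (- C (g 0) * K01 + C (g 2) * K12)
          - C (m 1) * (C (g 1) * K01 + C (g 2) * K02)) * r := by
        rw [hw01, map_sub, Dmul, Dmul, Dn, Dn, hgh, hN]
        linear_combination C (m 0) * (- C (g 0) * k01 + C (g 2) * k12)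
          - C (m 1) * (C (g 1) * k01 + C (g 2) * k02)
      rw [this]
      exact add_mem (J.mul_mem_left _ m01) (J.mul_mem_left _ mr)
    · have : D w02 = (α * gh) * w02 + (C (m 0) * (- C (g 0) * K02 - C (g 1) * K12)
          - C (m 2) * (C (g 1) * K01 + C (g 2) * K02)) * r := by
        rw [hw02, map_sub, Dmul, Dmul, Dn, Dn, hgh, hN]
        linear_combination C (m 0) * (- C (g 0) * k02 - C (g 1) * k12)
          - C (m 2) * (C (g 1) * k01 + C (g 2) * k02)
      rw [this]
      exact add_mem (J.mul_mem_left _ m02) (J.mul_mem_left _ mr)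
    · have : D w12 = (α * gh) * w12 + (C (m 1) * (- C (g 0) * K02 - C (g 1) * K12)
          - C (m 2) * (- C (g 0) * K01 + C (g 2) * K12)) * r := by
        rw [hw12, map_sub, Dmul, Dmul, Dn, Dn, hgh, hN]
        linear_combination C (m 1) * (- C (g 0) * k02 - C (g 1) * k12)
          - C (m 2) * (- C (g 0) * k01 + C (g 2) * k12)
      rw [this]
      exact add_mem (J.mul_mem_left _ m12) (J.mul_mem_left _ mr)
  have en : ∀ i, eval p (n i) = m i := fun i => (hm i).symm
  have hvan : ∀ x ∈ J, eval p x = 0 := by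
    have : J ≤ RingHom.ker (eval p) := by
      rw [hJ, Ideal.span_le]
      intro x hx
      simp only [hS, Set.mem_insert_iff, Set.mem_singleton_iff] at hx
      rw [SetLike.mem_coe, RingHom.mem_ker]
      rcases hx with rfl | rfl | rfl | rfl | rfl
      · exact hrp
      · rw [hℓ, eval_linForm, hmp]
      · simp only [hw01, map_sub, map_mul, eval_C, en]; ring
      · simp only [hw02, map_sub, map_mul, eval_C, en]; ring
      · simp only [hw12, map_sub, map_mul, eval_C, en]; ring
    intro x hx
    exact this hx
  set β : MvPolynomial (Fin 3) k := C (g 0 * p 2) * X 1 - C (g 0 * p 1) * X 2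
    + C (g 1 * p 0) * X 2 - C (g 1 * p 2) * X 0 + C (g 2 * p 1) * X 0 - C (g 2 * p 0) * X 1 with hβ
  have eβ : ∀ v, eval v β = g 0 * (v 1 * p 2 - v 2 * p 1) + g 1 * (v 2 * p 0 - v 0 * p 2)
      + g 2 * (v 0 * p 1 - v 1 * p 0) := by
    intro v
    simp only [hβ, map_sub, map_add, map_mul, eval_C, eval_X]; ring
  have eα : ∀ v, eval v α = dot3 e v := fun v => eval_linForm e v
  have hβp : eval p β = 0 := by rw [eβ]; ring
  have hDβ : eval p (D β) ≠ 0 := by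
    have : eval p (D β) = (dot3 e p) ^ 2 * (dot3 m g) ^ 2 := by
      simp only [hβ, map_sub, map_add, Dmul, DX, t0, t1, t2, hN]
      simp only [map_sub, map_add, map_mul, eval_C, en, eα]
      simp only [dot3] at hmp ⊢
      linear_combination -(e 0 * p 0 + e 1 * p 1 + e 2 * p 2) * (m 0 * g 0 + m 1 * g 1 + m 2 * g 2)
        * (e 0 * g 0 + e 1 * g 1 + e 2 * g 2) * hmp
    rw [this]
    exact mul_ne_zero (pow_ne_zero _ he) (pow_ne_zero _ hg)
  -- restriction of `q` to the line
  set b : Fin 3 → k := ![e 1 * m 2 - e 2 * m 1, e 2 * m 0 - e 0 * m 2, e 0 * m 1 - e 1 * m 0] with hb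
  set P : Fin 3 → k := fun i => dot3 m g * p i with hP
  have hline := aeval_line hq P b (A := MvPolynomial (Fin 3) k) α β
  set B := aeval (fun i => algebraMap k (MvPolynomial (Fin 3) k) (P i) * α
    + algebraMap k (MvPolynomial (Fin 3) k) (b i) * β) q with hB
  set κ := dot3 m g * dot3 e p with hκ
  have hκ0 : κ ≠ 0 := mul_ne_zero hg he
  have eB : ∀ v, dot3 m v = 0 → eval v B = κ ^ 4 * eval v q := by
    intro v hv
    rw [← homog_scale hq]
    have h1 : ∀ φ : Fin 3 → MvPolynomial (Fin 3) k,
        eval v (aeval φ q) = eval (fun i => eval v (φ i)) q := by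
      intro φ
      have : (aeval v : MvPolynomial (Fin 3) k →ₐ[k] k).comp (aeval φ) =
          (aeval (fun i => eval v (φ i)) : MvPolynomial (Fin 3) k →ₐ[k] k) := by
        apply MvPolynomial.algHom_ext
        intro i
        simp
      have := congrArg (fun f => f q) this
      simpa [MvPolynomial.coe_aeval_eq_eval] using this
    rw [hB, h1]
    congr 2
    funext i
    simp only [map_add, map_mul, algebraMap_eq, eval_C, eα, eβ, hP, hκ, Pi.smul_apply, smul_eq_mul]
    simp only [dot3] at hmp hv ⊢
    fin_cases i <;> simp only [hb, Fin.isValue, Fin.zero_eta, Fin.mk_one, Fin.reduceFinMk,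
      Matrix.cons_val_zero, Matrix.cons_val_one, Matrix.cons_val]
    · linear_combination (g 0 * (e 0 * v 0 + e 1 * v 1 + e 2 * v 2)
        - v 0 * (e 0 * g 0 + e 1 * g 1 + e 2 * g 2)) * hmp
        - (g 0 * (e 0 * p 0 + e 1 * p 1 + e 2 * p 2)
        - p 0 * (e 0 * g 0 + e 1 * g 1 + e 2 * g 2)) * hv
    · linear_combination (g 1 * (e 0 * v 0 + e 1 * v 1 + e 2 * v 2)
        - v 1 * (e 0 * g 0 + e 1 * g 1 + e 2 * g 2)) * hmp
        - (g 1 * (e 0 * p 0 + e 1 * p 1 + e 2 * p 2)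
        - p 1 * (e 0 * g 0 + e 1 * g 1 + e 2 * g 2)) * hv
    · linear_combination (g 2 * (e 0 * v 0 + e 1 * v 1 + e 2 * v 2)
        - v 2 * (e 0 * g 0 + e 1 * g 1 + e 2 * g 2)) * hmp
        - (g 2 * (e 0 * p 0 + e 1 * p 1 + e 2 * p 2)
        - p 2 * (e 0 * g 0 + e 1 * g 1 + e 2 * g 2)) * hv
  have hBJ : B ∈ J := by
    have hm0 : m ≠ 0 := by
      rintro rfl
      simp [dot3] at hg
    obtain ⟨U, hU⟩ := linForm_dvd m hm0 (C (κ ^ 4) * q - B) (by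
      intro v hv
      rw [map_sub, map_mul, eval_C, eB v hv, sub_self])
    have : B = (C (κ ^ 4) * s) * r - U * ℓ := by
      rw [hℓ]
      linear_combination C (κ ^ 4) * hqr - hU
    rw [this]
    exact sub_mem (J.mul_mem_left _ mr) (J.mul_mem_left _ mℓ)
  have ord := stable_order D J hst p hvan β hβp hDβ
  have hαp : eval p α ≠ 0 := by rw [eα]; exact he
  simp only [algebraMap_eq] at hline
  set f := co q P b with hf
  have f0 : f 0 = 0 := by
    have := hvan _ hBJ
    rw [hline] at this
    simpa [hβp, hαp] using this
  have f1 : f 1 = 0 := by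
    have := ord 1 (hchar 1 (by norm_num)) (C (f 1) * α ^ 3 + β * (C (f 2) * α ^ 2
      + C (f 3) * α * β + C (f 4) * β ^ 2)) (by
        convert hBJ using 1; rw [hline, f0, C_0]; ring)
    simpa [hβp, hαp] using this
  have f2 : f 2 = 0 := by
    have := ord 2 (hchar 2 (by norm_num)) (C (f 2) * α ^ 2 + β * (
      C (f 3) * α + C (f 4) * β)) (by
        convert hBJ using 1; rw [hline, f0, f1, C_0]; ring)
    simpa [hβp, hαp] using this
  have f3 : f 3 = 0 := by
    have := ord 3 (hchar 3 (by norm_num)) (C (f 3) * α + β * C (f 4)) (by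
        convert hBJ using 1; rw [hline, f0, f1, f2, C_0]; ring)
    simpa [hβp, hαp] using this
  have f4 : f 4 = 0 := by
    have := ord 4 (hchar 4 (by norm_num)) (C (f 4)) (by
        convert hBJ using 1; rw [hline, f0, f1, f2, f3, C_0]; ring)
    simpa [hβp, hαp] using this
  intro v hv
  have h1 := eB v hv
  rw [hline, f0, f1, f2, f3, f4] at h1
  simp only [zero_mul, add_zero, map_zero] at h1
  exact (mul_eq_zero.1 h1.symm).resolve_left (pow_ne_zero _ hκ0)

/-! ### Finiteness -/

lemma parallel_of_perp {k : Type*} [Field k] (d n : Fin 3 → k) (hd : d ≠ 0)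
    (h : ∀ v, dot3 d v = 0 → dot3 n v = 0) : ∃ c : k, c • d = n := by
  have h01 := h ![d 1, - d 0, 0] (by simp [dot3]; ring)
  have h02 := h ![d 2, 0, - d 0] (by simp [dot3]; ring)
  have h12 := h ![0, d 2, - d 1] (by simp [dot3]; ring)
  simp [dot3] at h01 h02 h12
  have hall : ∀ i j, n i * d j = n j * d i := by
    intro i j
    fin_cases i <;> fin_cases j <;> simp only [Fin.zero_eta, Fin.mk_one, Fin.reduceFinMk]
    · linear_combination h01
    · linear_combination h02
    · linear_combination -h01
    · linear_combination h12
    · linear_combination -h02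
    · linear_combination -h12
  obtain ⟨i, hi⟩ := Function.ne_iff.1 hd
  refine ⟨n i * (d i)⁻¹, ?_⟩
  have hinv := mul_inv_cancel₀ hi
  funext j
  simp only [Pi.smul_apply, smul_eq_mul]
  apply mul_left_cancel₀ hi
  linear_combination n i * d j * hinv + hall i j

lemma infPt_smul {k : Type*} [Field k] {q : MvPolynomial (Fin 3) k} (hq : q.IsHomogeneous 4)
    {d p : Fin 3 → k} (h : InfPt q d p) (t : k) : InfPt q d (t • p) := by
  obtain ⟨h0, h1, h2⟩ := h
  refine ⟨?_, ?_, fun v hv => ⟨?_, ?_⟩⟩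
  · simp only [dot3, Pi.smul_apply, smul_eq_mul] at h0 ⊢
    linear_combination t * h0
  · rw [homog_scale hq, h1, mul_zero]
  · have := (h2 v hv).1
    simp only [homog_scale (hq.pderiv), mul_assoc, ← Finset.mul_sum]
    rw [this, mul_zero]
  · have := (h2 v hv).2
    simp only [homog_scale (hq.pderiv.pderiv), mul_assoc, ← Finset.mul_sum] at this ⊢
    rw [this, mul_zero]

lemma quad_zero {k : Type*} [Field k] (h2 : (2 : k) ≠ 0) (A : Fin 3 → Fin 3 → k)
    (hsymm : ∀ i j, A i j = A j i)
    (hv : ∀ v : Fin 3 → k, ∑ i, ∑ j, A i j * v j * v i = 0) (i j : Fin 3) : A i j = 0 := by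
  have a0 := hv ![1, 0, 0]
  have a1 := hv ![0, 1, 0]
  have a2 := hv ![0, 0, 1]
  have a01 := hv ![1, 1, 0]
  have a02 := hv ![1, 0, 1]
  have a12 := hv ![0, 1, 1]
  simp [Fin.sum_univ_three] at a0 a1 a2 a01 a02 a12
  rw [hsymm 1 0, a0, a1] at a01
  rw [hsymm 2 0, a0, a2] at a02
  rw [hsymm 2 1, a1, a2] at a12
  have b01 : A 0 1 = 0 := mul_left_cancel₀ h2 (by linear_combination a01)
  have b02 : A 0 2 = 0 := mul_left_cancel₀ h2 (by linear_combination a02)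
  have b12 : A 1 2 = 0 := mul_left_cancel₀ h2 (by linear_combination a12)
  have b10 := (hsymm 1 0).trans b01
  have b20 := (hsymm 2 0).trans b02
  have b21 := (hsymm 2 1).trans b12
  fin_cases i <;> fin_cases j <;> assumption

lemma infPt_fibre {k : Type*} [Field k] [Infinite k] (h6 : (6 : k) ≠ 0)
    {q : MvPolynomial (Fin 3) k} (p : Fin 3 → k)
    (hm : (∀ i, eval p (pderiv i q) = 0) → ∃ i j, eval p (pderiv i (pderiv j q)) ≠ 0) :
    {P : Projectivization k (Fin 3 → k) | InfPt q P.rep p}.Finite := by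
  have h2 : (2 : k) ≠ 0 := fun h => h6 (by linear_combination 3 * h)
  by_cases hn : (fun i => eval p (pderiv i q)) = 0
  · obtain ⟨i, j, hij⟩ := hm (fun i => congrFun hn i)
    set A : Fin 3 → Fin 3 → k := fun i j => eval p (pderiv j (pderiv i q)) with hA
    have hsymm : ∀ i j, A i j = A j i := fun i j => by simp only [hA]; rw [pderiv_comm']
    set Q : MvPolynomial (Fin 3) k := ∑ i, ∑ j, C (A i j) * X j * X i with hQ
    have eQ : ∀ v, eval v Q = ∑ i, ∑ j, A i j * v j * v i := by
      intro v; simp [hQ]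
    have hQ0 : Q ≠ 0 := by
      intro h0
      have hv : ∀ v : Fin 3 → k, ∑ i, ∑ j, A i j * v j * v i = 0 := by
        intro v; rw [← eQ, h0, map_zero]
      exact hij (quad_zero h2 A hsymm hv j i)
    refine (finite_lines Q hQ0).subset ?_
    intro P hP v hv
    rw [eQ]
    exact (hP.2.2 v hv).2
  · refine (Set.finite_singleton (Projectivization.mk k _ hn)).subset ?_
    intro P hP
    obtain ⟨c, hc⟩ := parallel_of_perp P.rep (fun i => eval p (pderiv i q)) P.rep_nonzero
      (fun v hv => by
      have := (hP.2.2 v hv).1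
      rw [Fin.sum_univ_three] at this
      exact this)
    rw [Set.mem_singleton_iff]
    conv_lhs => rw [← P.mk_rep]
    symm
    rw [Projectivization.mk_eq_mk_iff']
    exact ⟨c, hc⟩

lemma infPt_hessTau {k : Type*} [Field k] {q : MvPolynomial (Fin 3) k} {d p : Fin 3 → k}
    (hd : d ≠ 0) (h : InfPt q d p) (e : Fin 3 → k) : eval p (hessTau q e) = 0 := by
  obtain ⟨c, hc⟩ := parallel_of_perp d (fun i => eval p (pderiv i q)) hd (fun v hv => by
    have := (h.2.2 v hv).1
    rw [Fin.sum_univ_three] at this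
    exact this)
  set τ : Fin 3 → k := ![e 1 * d 2 - e 2 * d 1, e 2 * d 0 - e 0 * d 2, e 0 * d 1 - e 1 * d 0]
    with hτ
  have h1 := (h.2.2 τ (by simp [dot3, hτ]; ring)).2
  have hc' : ∀ i, eval p (pderiv i q) = c * d i := fun i => (congrFun hc i).symm
  have ht : ∀ i, eval p (tau q e i) = c * τ i := by
    intro i
    fin_cases i <;> simp [tau, hτ, hc'] <;> ring
  rw [hessTau]
  simp only [map_sum, map_mul, ht]
  rw [← mul_zero (c ^ 2), ← h1]
  simp only [Finset.mul_sum]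
  exact Finset.sum_congr rfl fun i _ => Finset.sum_congr rfl fun j _ => by ring

lemma exists_pderiv {k : Type*} [Field k] (h6 : (6 : k) ≠ 0)
    {q r s : MvPolynomial (Fin 3) k} (hq : q.IsHomogeneous 4) (hq0 : q ≠ 0) (hqr : q = r * s)
    (hr : Prime r) (hrs : ¬ r ∣ s) : ∃ c, ¬ r ∣ pderiv c q := by
  have h2 : (2 : k) ≠ 0 := fun h => h6 (by linear_combination 3 * h)
  have h3 : (3 : k) ≠ 0 := fun h => h6 (by linear_combination 2 * h)
  have h4 : (4 : k) ≠ 0 := fun h => mul_ne_zero h2 h2 (by linear_combination h)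
  by_contra! hall
  obtain ⟨i, hi, hri⟩ := homog_of_mul (hqr ▸ hq0) (hqr ▸ hq)
  have hi0 : i ≠ 0 := by
    rintro rfl
    have hdeg := hri.totalDegree hr.ne_zero
    have hC := totalDegree_eq_zero_iff_eq_C.1 hdeg
    apply hr.not_isUnit
    rw [hC]
    refine IsUnit.map C (isUnit_iff_ne_zero.2 fun h0 => hr.ne_zero ?_)
    rw [hC, h0, C_0]
  have hp0 : ∀ c, pderiv c r = 0 := by
    intro c
    by_contra hne
    have h1 : r ∣ pderiv c r * s := by
      obtain ⟨t, ht⟩ := hall c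
      rw [hqr, pderiv_mul] at ht
      exact ⟨t - pderiv c s, by linear_combination ht⟩
    obtain ⟨t, ht⟩ := (hr.dvd_or_dvd h1).resolve_right hrs
    have ht0 : t ≠ 0 := by
      rintro rfl; exact hne (by rw [ht, mul_zero])
    have hd1 := (hri.pderiv (i := c)).totalDegree hne
    rw [ht, totalDegree_mul_of_isDomain hr.ne_zero ht0, hri.totalDegree hr.ne_zero] at hd1
    omega
  have := hri.sum_X_mul_pderiv
  simp only [hp0, mul_zero, Finset.sum_const_zero] at this
  have hi' : ((i : ℕ) : k) ≠ 0 := by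
    interval_cases i <;> norm_num <;> first | assumption | exact absurd rfl hi0
  have h7 : C (i : k) * r = 0 := by
    rw [this, nsmul_eq_mul, map_natCast]
  rcases mul_eq_zero.1 h7 with h | h
  · exact hi' (C_injective _ _ (by rw [h, C_0]))
  · exact hr.ne_zero h

lemma component_finite {k : Type*} [Field k] [Infinite k] (h6 : (6 : k) ≠ 0)
    {q r s : MvPolynomial (Fin 3) k} (hq : q.IsHomogeneous 4) (hq0 : q ≠ 0) (hqr : q = r * s)
    (hr : Prime r) (hrs : ¬ r ∣ s) :
    {Q : Projectivization k (Fin 3 → k) | eval Q.rep r = 0 ∧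
      ∃ P : Projectivization k (Fin 3 → k), InfPt q P.rep Q.rep ∧
        ¬ ∀ v, dot3 P.rep v = 0 → eval v q = 0}.Finite := by
  obtain ⟨i, hi, hri⟩ := homog_of_mul (hqr ▸ hq0) (hqr ▸ hq)
  obtain ⟨c, hc⟩ := exists_pderiv h6 hq hq0 hqr hr hrs
  have hsing : {Q : Projectivization k (Fin 3 → k) | eval Q.rep r = 0 ∧
      eval Q.rep (pderiv c q) = 0}.Finite := by
    refine weak_bezout r _ hr.irreducible hc _ ?_
    rintro Q ⟨h1, h2⟩ t
    rw [homog_scale hri, homog_scale hq.pderiv, h1, h2]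
    simp
  by_cases hall : ∀ e, r ∣ hessTau q e
  · refine hsing.subset ?_
    rintro Q ⟨h1, P, hP, hnot⟩
    refine ⟨h1, ?_⟩
    by_contra hcne
    apply hnot
    obtain ⟨j, hj⟩ := Function.ne_iff.1 Q.rep_nonzero
    have hA := lemmaA h6 hq hqr hr hrs (Pi.single j 1) (Pi.single c 1) Q.rep
      (fun i => eval Q.rep (pderiv i q)) (hall _) h1 (fun i => rfl)
      (by
        have : dot3 (Pi.single j 1) Q.rep = Q.rep j := by
          fin_cases j <;> simp [dot3]
        rw [this]; exact hj)
      (by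
        have : dot3 (fun i => eval Q.rep (pderiv i q)) (Pi.single c 1)
            = eval Q.rep (pderiv c q) := by
          fin_cases c <;> simp [dot3]
        rw [this]; exact hcne)
    intro v hv
    apply hA
    have := (hP.2.2 v hv).1
    rw [Fin.sum_univ_three] at this
    exact this
  · push Not at hall
    obtain ⟨e, he⟩ := hall
    refine weak_bezout r _ hr.irreducible he _ ?_
    rintro Q ⟨h1, P, hP, -⟩ t
    refine ⟨by rw [homog_scale hri, h1, mul_zero], ?_⟩
    exact infPt_hessTau P.rep_nonzero (infPt_smul hq hP t) e


/-- Over an algebraically closed field of characteristic coprime to `6`,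
a reduced plane quartic all of whose singular points have multiplicity `2` has a finite
common zero locus `{H(q) = K(q) = 0}` in the dual projective plane; equivalently, it has
finitely many inflection lines. -/
theorem stmt7 {k : Type*} [Field k] [IsAlgClosed k] (h6 : (6 : k) ≠ 0)
    (q : MvPolynomial (Fin 3) k) (hq4 : q.IsHomogeneous 4) (hsf : Squarefree q)
    (hmult2 : ∀ pt : Fin 3 → k, pt ≠ 0 → eval pt q = 0 →
      (∀ i, eval pt (pderiv i q) = 0) → ∃ i j, eval pt (pderiv i (pderiv j q)) ≠ 0)
    (H K : MvPolynomial (Fin 3) k)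
    (hH : X 0 ^ 4 * H = SG q) (hK : X 0 ^ 6 * K = TG q) :
    {P : Projectivization k (Fin 3 → k) |
      eval P.rep H = 0 ∧ eval P.rep K = 0}.Finite := by
  have hq0 : q ≠ 0 := hsf.ne_zero
  set bad1 : Set (Projectivization k (Fin 3 → k)) :=
    {P | ∀ v, dot3 P.rep v = 0 → eval v q = 0} with hbad1
  have hb1 : bad1.Finite := finite_lines q hq0
  set bad2 : Set (Projectivization k (Fin 3 → k)) := {P | P.rep 0 = 0 ∧ P.rep 1 = 0} with hbad2
  have hb2 : bad2.Finite := by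
    have hne : (![0, 0, 1] : Fin 3 → k) ≠ 0 := fun h => by simpa using congrFun h 2
    refine (Set.finite_singleton (Projectivization.mk k _ hne)).subset ?_
    rintro P ⟨h0, h1⟩
    rw [Set.mem_singleton_iff]
    conv_lhs => rw [← P.mk_rep]
    rw [Projectivization.mk_eq_mk_iff']
    refine ⟨P.rep 2, ?_⟩
    funext i
    fin_cases i <;> simp [h0, h1]
  set comp : MvPolynomial (Fin 3) k → Set (Projectivization k (Fin 3 → k)) := fun r =>
    {Q | eval Q.rep r = 0 ∧ ∃ P : Projectivization k (Fin 3 → k), InfPt q P.rep Q.rep ∧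
        ¬ ∀ v, dot3 P.rep v = 0 → eval v q = 0} with hcomp
  have hfac : {r | r ∈ UniqueFactorizationMonoid.factors q}.Finite := Multiset.finite_toSet _
  have hcf : ∀ r ∈ {r | r ∈ UniqueFactorizationMonoid.factors q}, (comp r).Finite := by
    intro r hr
    have hrp := UniqueFactorizationMonoid.prime_of_factor r hr
    obtain ⟨s, hs⟩ := UniqueFactorizationMonoid.dvd_of_mem_factors hr
    refine component_finite h6 hq4 hq0 hs hrp ?_
    rintro ⟨t, ht⟩
    exact hrp.not_isUnit (hsf r ⟨t, by rw [hs, ht, mul_assoc]⟩)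
  have hfin := hfac.biUnion hcf
  have hfin2 := hfin.biUnion (t := fun Q : Projectivization k (Fin 3 → k) =>
    {P : Projectivization k (Fin 3 → k) | eval Q.rep q = 0 ∧ InfPt q P.rep Q.rep}) (by
      intro Q _
      by_cases hQ : eval Q.rep q = 0
      · refine (infPt_fibre h6 (q := q) Q.rep (hmult2 _ Q.rep_nonzero hQ)).subset ?_
        rintro P ⟨-, hP⟩
        exact hP
      · refine Set.finite_empty.subset ?_
        rintro P ⟨h, -⟩
        exact hQ h)
  refine ((hb1.union hb2).union hfin2).subset ?_
  rintro P ⟨h1, h2⟩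
  by_cases hP1 : P ∈ bad1
  · exact Or.inl (Or.inl hP1)
  by_cases hP2 : P ∈ bad2
  · exact Or.inl (Or.inr hP2)
  right
  have hd : P.rep 0 ≠ 0 ∨ P.rep 1 ≠ 0 := by
    by_contra! h
    exact hP2 h
  obtain ⟨p, hp0, hp⟩ := exists_infPt h6 hq4 H K hH hK P.rep hd h1 h2
  set Q := Projectivization.mk k p hp0 with hQ
  have hQi : InfPt q P.rep Q.rep := by
    obtain ⟨a, ha⟩ := Projectivization.exists_smul_eq_mk_rep k p hp0
    rw [hQ, ← ha]
    exact infPt_smul hq4 hp (a : k)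
  obtain ⟨r, hr, hr0⟩ : ∃ r ∈ UniqueFactorizationMonoid.factors q, eval Q.rep r = 0 := by
    have hassoc := UniqueFactorizationMonoid.factors_prod hq0
    have h0 : eval Q.rep (UniqueFactorizationMonoid.factors q).prod = 0 := by
      obtain ⟨t, ht⟩ := hassoc.symm.dvd
      rw [ht, map_mul, hQi.2.1, zero_mul]
    rw [map_multiset_prod, Multiset.prod_eq_zero_iff, Multiset.mem_map] at h0
    exact h0
  simp only [Set.mem_iUnion]
  exact ⟨Q, ⟨r, hr, hr0, P, hQi, hP1⟩, hQi.2.1, hQi⟩
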